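/- Let h be a complex Laurent polynomial with ‖h(z)‖ = 1 for all z on the unit circle, h(1) = 1, and such that the loop z ↦ h(z), viewed as a continuous map from the unit circle into ℂ \ {0}, is homotopic to a constant map. Then h(z) = 1 for every z on the unit circle. -/

import Mathlib

open Polynomial in
/-- A unimodular Laurent polynomial with value `1` at `1` is a monomial on the unit circle. -/
theorem laurent_unimodular_monomial (s : Finset ℤ) (c : ℤ → ℂ)
    (h1 : ∀ z : ℂ, ‖z‖ = 1 → ‖∑ j ∈ s, c j * z ^ j‖ = 1)
    (hbase : ∑ j ∈ s, c j = 1) :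
    ∃ n : ℤ, ∀ z : ℂ, ‖z‖ = 1 → ∑ j ∈ s, c j * z ^ j = z ^ n := by
  set N : ℕ := s.sup Int.natAbs with hN
  have hle : ∀ j ∈ s, j.natAbs ≤ N := fun j hj => Finset.le_sup (f := Int.natAbs) hj
  set P : ℂ[X] := ∑ j ∈ s, C (c j) * X ^ (N + j).toNat with hP
  set Q : ℂ[X] := ∑ j ∈ s, C (star (c j)) * X ^ (N - j).toNat with hQ
  have hPe : ∀ z : ℂ, ‖z‖ = 1 → P.eval z = z ^ N * ∑ j ∈ s, c j * z ^ j := by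
    intro z hz
    have hz0 : z ≠ 0 := by rintro rfl; simp at hz
    rw [hP, eval_finsetSum, Finset.mul_sum]
    refine Finset.sum_congr rfl fun j hj => ?_
    have := hle j hj
    have e : z ^ (N + j).toNat = z ^ N * z ^ j := by
      rw [← zpow_natCast, Int.toNat_of_nonneg (by omega), zpow_add₀ hz0, zpow_natCast]
    simp only [eval_mul, eval_C, eval_pow, eval_X, e]
    ring
  have hQe : ∀ z : ℂ, ‖z‖ = 1 → Q.eval z = z ^ N * star (∑ j ∈ s, c j * z ^ j) := by
    intro z hz
    have hz0 : z ≠ 0 := by rintro rfl; simp at hz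
    have hinv : star z = z⁻¹ := by
      rw [Complex.inv_def, Complex.normSq_eq_norm_sq, hz]; simp
    rw [hQ, eval_finsetSum, star_sum, Finset.mul_sum]
    refine Finset.sum_congr rfl fun j hj => ?_
    have := hle j hj
    have e : z ^ (N - j).toNat = z ^ N * (z ^ j)⁻¹ := by
      rw [← zpow_natCast, Int.toNat_of_nonneg (by omega), zpow_sub₀ hz0, zpow_natCast]
      rfl
    simp only [eval_mul, eval_C, eval_pow, eval_X, e, star_mul', star_zpow₀, hinv, inv_zpow]
    ring
  have hinf : (Metric.sphere (0 : ℂ) 1).Infinite := by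
    refine (isPreconnected_sphere (by simp) (0 : ℂ) 1).infinite_of_nontrivial ?_
    exact ⟨1, by simp, -1, by simp, by norm_num⟩
  have hPQ : P * Q = X ^ (N + N) := by
    refine eq_of_infinite_eval_eq _ _ (hinf.mono fun z hz => ?_)
    have hz' : ‖z‖ = 1 := by simpa using hz
    have hh : (∑ j ∈ s, c j * z ^ j) * star (∑ j ∈ s, c j * z ^ j) = 1 := by
      have := Complex.mul_conj (∑ j ∈ s, c j * z ^ j)
      rw [Complex.normSq_eq_norm_sq, h1 z hz'] at this
      simpa using this
    simp only [Set.mem_ofPred_eq, eval_mul, hPe z hz', hQe z hz', eval_pow, eval_X, pow_add]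
    linear_combination z ^ N * z ^ N * hh
  obtain ⟨i, -, hi⟩ := (dvd_prime_pow prime_X (N + N)).1 ⟨Q, hPQ.symm⟩
  obtain ⟨u, hu⟩ := hi.symm
  obtain ⟨r, hr, hru⟩ := Polynomial.isUnit_iff.1 u.isUnit
  have hev : ∀ z : ℂ, ‖z‖ = 1 → z ^ N * ∑ j ∈ s, c j * z ^ j = z ^ i * r := by
    intro z hz
    rw [← hPe z hz, ← hu, ← hru]; simp only [eval_mul, eval_pow, eval_X, eval_C]
  have hr1 : r = 1 := by
    have := hev 1 (by simp)
    simpa [hbase] using this.symm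
  refine ⟨(i : ℤ) - N, fun z hz => ?_⟩
  have hz0 : z ≠ 0 := by rintro rfl; simp at hz
  have := hev z hz
  rw [hr1, mul_one] at this
  rw [zpow_sub₀ hz0, zpow_natCast, zpow_natCast, eq_div_iff (pow_ne_zero _ hz0), ← this]
  ring


/-- A complex Laurent polynomial which is unimodular on the unit circle,
takes the value `1` at `z = 1`, and is null homotopic as a loop in `ℂ \ {0}`, is identically
`1` on the unit circle. -/
theorem laurent_unimodular_nullhomotopic_eq_one
    (s : Finset ℤ) (c : ℤ → ℂ)
    (h1 : ∀ z : ℂ, ‖z‖ = 1 → ‖∑ j ∈ s, c j * z ^ j‖ = 1)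
    (hbase : ∑ j ∈ s, c j = 1)
    (hnull : ∃ (f : C({z : ℂ // ‖z‖ = 1}, {w : ℂ // w ≠ 0}))
        (w : {w : ℂ // w ≠ 0}),
        (∀ z : {z : ℂ // ‖z‖ = 1}, (f z : ℂ) = ∑ j ∈ s, c j * (z : ℂ) ^ j) ∧
        ContinuousMap.Homotopic f (ContinuousMap.const _ w)) :
    ∀ z : ℂ, ‖z‖ = 1 → ∑ j ∈ s, c j * z ^ j = 1 := by
  obtain ⟨n, hn⟩ := laurent_unimodular_monomial s c h1 hbase
  obtain ⟨f, w, hf, hom⟩ := hnull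
  obtain ⟨F⟩ := hom.symm
  obtain ⟨g, hg⟩ : ∃ g : C({z : ℂ // ‖z‖ = 1}, ℂ), ∀ z, Complex.exp (g z) = f z := by
    have H0 : ∀ a : {z : ℂ // ‖z‖ = 1}, F.toContinuousMap (0, a) =
        (fun z : ℂ ↦ (⟨_, z.exp_ne_zero⟩ : {z : ℂ // z ≠ 0}))
          (ContinuousMap.const {z : ℂ // ‖z‖ = 1} (Complex.log w) a) := by
      intro a
      have : F.toContinuousMap (0, a) = w := F.map_zero_left a
      rw [this]
      exact Subtype.ext (Complex.exp_log w.2).symm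
    refine ⟨(Complex.isCoveringMap_exp.liftHomotopy F.toContinuousMap _ H0).comp
      ((ContinuousMap.const _ 1).prodMk (ContinuousMap.id _)), fun z => ?_⟩
    have e := congr_fun
      (Complex.isCoveringMap_exp.liftHomotopy_lifts F.toContinuousMap _ H0) (1, z)
    have e1 : F.toContinuousMap (1, z) = f z := F.map_one_left z
    rw [e1] at e
    exact congr_arg Subtype.val e
  let E : ℝ → {z : ℂ // ‖z‖ = 1} :=
    fun t => ⟨Complex.exp (t * Complex.I), Complex.norm_exp_ofReal_mul_I t⟩
  have hE : Continuous E := by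
    refine Continuous.subtype_mk ?_ _
    fun_prop
  have hG : Continuous fun t : ℝ => g (E t) - n * (t * Complex.I) := by
    have := g.continuous.comp hE
    exact this.sub (by fun_prop)
  have hexp : ∀ t : ℝ, Complex.exp (g (E t) - n * (t * Complex.I)) = 1 := by
    intro t
    rw [Complex.exp_sub, hg, hf, hn _ (E t).2, Complex.exp_int_mul]
    exact div_self (zpow_ne_zero _ (Complex.exp_ne_zero _))
  have hc := Complex.isCoveringMap_exp.const_of_comp hG
    (fun a a' => Subtype.ext ((hexp a).trans (hexp a').symm)) 0 (2 * Real.pi)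
  have hE0 : E (2 * Real.pi) = E 0 := by
    apply Subtype.ext
    simp [E, Complex.exp_two_pi_mul_I]
  have hn0 : n = 0 := by
    simp only [hE0] at hc
    have : (n : ℂ) * (2 * Real.pi * Complex.I) = 0 := by
      push_cast at hc
      linear_combination hc
    rcases mul_eq_zero.1 this with h | h
    · exact_mod_cast h
    · exact absurd h Complex.two_pi_I_ne_zero
  intro z hz
  rw [hn z hz, hn0, zpow_zero]
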